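/- arXiv:2601.18559 — 2 statements merged into one kernel-verified Lean document; each statement's English description precedes it below -/
import Mathlib

section
/- For every integer s ≥ 1 and every real number c, if μ is a compactly supported Borel probability measure on ℝ satisfying ∫ Q_n^s dμ = e^{-cn} for all n ∈ ℕ, then μ equals the measure η_c^s := f_c·ν_s + 1_{c<0}·((e^{-c} − e^{c})/(e^{-c} + √s))·δ_{e^{c}+√s+e^{-c}}. -/
open MeasureTheory Polynomial Filter

/-- The orthogonal polynomials `Q_n^s`: `Q_0 = 1`, `Q_1 = X`,
`X * Q_n = Q_{n+1} + √s * Q_n + Q_{n-1}`. -/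
noncomputable def Qpoly (s : ℕ) : ℕ → Polynomial ℝ
  | 0 => 1
  | 1 => Polynomial.X
  | (n + 2) => Polynomial.X * Qpoly s (n + 1)
      - Polynomial.C (Real.sqrt s) * Qpoly s (n + 1) - Qpoly s n

/-- Chebyshev polynomials of the second kind: `P_0 = 1`, `P_1 = X`,
`X * P_n = P_{n+1} + P_{n-1}`. -/
noncomputable def Ppoly : ℕ → Polynomial ℝ
  | 0 => 1
  | 1 => Polynomial.X
  | (n + 2) => Polynomial.X * Ppoly (n + 1) - Ppoly n

/-- The density of the absolutely continuous part of `ν_s`. -/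
noncomputable def nuDensity (s : ℕ) (x : ℝ) : ℝ :=
  Real.sqrt (4 - (x - Real.sqrt s) ^ 2) / (2 * Real.pi * (x * Real.sqrt s + 1))

/-- The free Meixner measure `ν_s`. -/
noncomputable def nuMeas (s : ℕ) : Measure ℝ :=
  volume.withDensity (fun x => ENNReal.ofReal
      (if |x - Real.sqrt s| ≤ 2 then nuDensity s x else 0))
    + ENNReal.ofReal (1 - 1 / (s : ℝ)) • Measure.dirac (-1 / Real.sqrt s)

/-- The density `f_c`. -/
noncomputable def fc (s : ℕ) (c x : ℝ) : ℝ :=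
  (Real.exp c + Real.sqrt s) / (Real.exp c + Real.exp (-c) + Real.sqrt s - x)

/-- The measure `η_c^s = f_c · ν_s + 1_{c<0} ((e^{-c}-e^c)/(e^{-c}+√s)) δ_{e^c+√s+e^{-c}}`. -/
noncomputable def etaMeas (s : ℕ) (c : ℝ) : Measure ℝ :=
  (nuMeas s).withDensity (fun x => ENNReal.ofReal (fc s c x))
    + (if c < 0 then
        ENNReal.ofReal ((Real.exp (-c) - Real.exp c) / (Real.exp (-c) + Real.sqrt s))
      else 0) • Measure.dirac (Real.exp c + Real.sqrt s + Real.exp (-c))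

/-- Total variation distance between two Borel measures on `ℝ`. -/
noncomputable def dTV (μ ν : Measure ℝ) : ℝ :=
  ⨆ A : {A : Set ℝ // MeasurableSet A}, |(μ A.1).toReal - (ν A.1).toReal|

lemma eval_Ppoly_add_two (n : ℕ) (x : ℝ) :
    (Ppoly (n + 2)).eval x = x * (Ppoly (n + 1)).eval x - (Ppoly n).eval x := by
  simp [Ppoly]

lemma eval_Ppoly_zero (x : ℝ) : (Ppoly 0).eval x = 1 := by simp [Ppoly]

lemma eval_Ppoly_one (x : ℝ) : (Ppoly 1).eval x = x := by simp [Ppoly]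

lemma eval_Qpoly_succ (s n : ℕ) (x : ℝ) :
    (Qpoly s (n + 1)).eval x =
      (Ppoly (n + 1)).eval (x - √s) + √s * (Ppoly n).eval (x - √s) := by
  induction n using Nat.twoStepInduction with
  | zero => simp [Qpoly, Ppoly]
  | one => simp [Qpoly, Ppoly]; ring
  | more n h1 h2 =>
    have e : (Qpoly s (n + 2 + 1)).eval x = x * (Qpoly s (n + 1 + 1)).eval x
        - √s * (Qpoly s (n + 1 + 1)).eval x - (Qpoly s (n + 1)).eval x := by
      simp [Qpoly]
    rw [e, h1, h2, eval_Ppoly_add_two (n + 1), eval_Ppoly_add_two n]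
    ring

lemma eval_Ppoly_two_cos_mul_sin (n : ℕ) (θ : ℝ) :
    (Ppoly n).eval (2 * Real.cos θ) * Real.sin θ = Real.sin ((n + 1) * θ) := by
  induction n using Nat.twoStepInduction with
  | zero => simp [Ppoly]
  | one =>
    rw [eval_Ppoly_one]
    norm_num [Real.sin_two_mul]
    ring
  | more n h1 h2 =>
    rw [eval_Ppoly_add_two, sub_mul, h1, mul_assoc, h2]
    have e1 : (((n + 2 : ℕ) : ℝ) + 1) * θ = (((n + 1 : ℕ) : ℝ) + 1) * θ + θ := by
      push_cast; ring
    have e2 : ((n : ℝ) + 1) * θ = (((n + 1 : ℕ) : ℝ) + 1) * θ - θ := by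
      push_cast; ring
    rw [e1, e2, Real.sin_add, Real.sin_sub]
    ring

lemma eval_Ppoly_succ_two_cos (n : ℕ) (θ : ℝ) :
    (Ppoly (n + 1)).eval (2 * Real.cos θ) =
      Real.cos θ * (Ppoly n).eval (2 * Real.cos θ) + Real.cos ((n + 1) * θ) := by
  induction n with
  | zero => simp [Ppoly]; ring
  | succ n ih =>
    rw [eval_Ppoly_add_two, ih]
    have h := eval_Ppoly_two_cos_mul_sin n θ
    have e : (((n + 1 : ℕ) : ℝ) + 1) * θ = ((n : ℝ) + 1) * θ + θ := by push_cast; ring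
    rw [e, Real.cos_add, ← h]
    linear_combination (eval (2 * Real.cos θ) (Ppoly n)) * Real.sin_sq_add_cos_sq θ

lemma exists_two_cos_eq {y : ℝ} (hy : |y| ≤ 2) : ∃ θ, y = 2 * Real.cos θ := by
  have := abs_le.1 hy
  exact ⟨Real.arccos (y / 2), by rw [Real.cos_arccos] <;> linarith⟩

lemma abs_eval_Ppoly_le (n : ℕ) {y : ℝ} (hy : |y| ≤ 2) :
    |(Ppoly n).eval y| ≤ n + 1 := by
  obtain ⟨θ, rfl⟩ := exists_two_cos_eq hy
  induction n with
  | zero => simp [Ppoly]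
  | succ n ih =>
    rw [eval_Ppoly_succ_two_cos]
    push_cast
    refine (abs_add_le _ _).trans (add_le_add ?_ (Real.abs_cos_le_one _))
    rw [abs_mul]
    calc _ ≤ 1 * |(Ppoly n).eval (2 * Real.cos θ)| := by
          gcongr; exact Real.abs_cos_le_one _
      _ ≤ _ := by simpa using ih

lemma exists_abs_eval_Ppoly_le {y : ℝ} (hy : |y| < 2) :
    ∃ C, ∀ n, |(Ppoly n).eval y| ≤ C := by
  obtain ⟨θ, rfl⟩ := exists_two_cos_eq hy.le
  have hs : 0 < |Real.sin θ| := by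
    rw [abs_pos]
    intro h
    have h1 := Real.sin_sq_add_cos_sq θ
    rw [abs_mul, abs_two] at hy
    have h2 : |Real.cos θ| < 1 := by linarith
    have h3 := (sq_lt_one_iff_abs_lt_one _).2 h2
    rw [h] at h1
    linarith
  refine ⟨1 / |Real.sin θ|, fun n => ?_⟩
  rw [le_div_iff₀ hs, ← abs_mul, eval_Ppoly_two_cos_mul_sin]
  exact Real.abs_sin_le_one _

lemma eval_Ppoly_neg (n : ℕ) (y : ℝ) :
    (Ppoly n).eval (-y) = (-1) ^ n * (Ppoly n).eval y := by
  induction n using Nat.twoStepInduction with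
  | zero => simp [Ppoly]
  | one => simp [Ppoly]
  | more n h1 h2 =>
    rw [eval_Ppoly_add_two, eval_Ppoly_add_two, h1, h2]
    ring

lemma add_one_le_eval_Ppoly (n : ℕ) {y : ℝ} (hy : 2 ≤ y) :
    (n : ℝ) + 1 ≤ (Ppoly n).eval y := by
  have key : (n : ℝ) + 1 ≤ (Ppoly n).eval y ∧
      (Ppoly n).eval y + 1 ≤ (Ppoly (n + 1)).eval y := by
    induction n with
    | zero => simp [Ppoly]; linarith
    | succ n ih =>
      obtain ⟨h1, h2⟩ := ih
      have hn : (0 : ℝ) ≤ n := n.cast_nonneg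
      refine ⟨by push_cast; linarith, ?_⟩
      rw [eval_Ppoly_add_two]
      nlinarith
  exact key.1

lemma eval_Ppoly_add_inv (n : ℕ) {t : ℝ} (ht : t ≠ 0) :
    (Ppoly n).eval (t + t⁻¹) = t ^ n * ∑ j ∈ Finset.range (n + 1), ((t ^ 2)⁻¹) ^ j := by
  induction n using Nat.twoStepInduction with
  | zero => simp [Ppoly]
  | one => simp [Ppoly, Finset.sum_range_succ]; field_simp
  | more n h1 h2 =>
    rw [eval_Ppoly_add_two, h1, h2, Finset.sum_range_succ _ (n + 2),
      Finset.sum_range_succ _ (n + 1)]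
    have e1 : t ^ 2 * (t ^ 2)⁻¹ = 1 := mul_inv_cancel₀ (pow_ne_zero 2 ht)
    have e2 : t⁻¹ = t * (t ^ 2)⁻¹ := by field_simp
    rw [e2]
    linear_combination t ^ n * (∑ j ∈ Finset.range (n + 1), ((t ^ 2)⁻¹) ^ j) * e1

lemma two_le_add_inv {t : ℝ} (ht : 0 < t) : 2 ≤ t + t⁻¹ := by
  have : t + t⁻¹ - 2 = (t - 1) ^ 2 / t := by field_simp; ring
  have h2 : 0 ≤ (t - 1) ^ 2 / t := by positivity
  linarith

lemma tendsto_eval_Ppoly_div_pow {t : ℝ} (ht : 1 < t) :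
    Tendsto (fun n : ℕ => (Ppoly n).eval (t + t⁻¹) / t ^ n) atTop
      (nhds (1 - (t ^ 2)⁻¹)⁻¹) := by
  have ht0 : t ≠ 0 := by positivity
  have h1 : (t ^ 2)⁻¹ < 1 := inv_lt_one_of_one_lt₀ (one_lt_pow₀ ht two_ne_zero)
  have h := (hasSum_geometric_of_lt_one (by positivity) h1).tendsto_sum_nat
  refine ((tendsto_add_atTop_iff_nat 1).2 h).congr fun n => ?_
  rw [eval_Ppoly_add_inv n ht0]
  field_simp

lemma tendsto_pow_div_eval_Ppoly {t : ℝ} (ht : 1 ≤ t) :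
    Tendsto (fun n : ℕ => t ^ n / (Ppoly n).eval (t + t⁻¹)) atTop
      (nhds (1 - (t ^ 2)⁻¹)) := by
  rcases ht.eq_or_lt with rfl | ht
  · simp only [one_pow, inv_one, sub_self]
    refine squeeze_zero (fun n => ?_) (fun n => ?_) tendsto_one_div_add_atTop_nhds_zero_nat
    · have := add_one_le_eval_Ppoly n (y := 1 + 1) (by norm_num)
      exact div_nonneg zero_le_one (le_trans (by positivity) this)
    · have := add_one_le_eval_Ppoly n (y := 1 + 1) (by norm_num)
      gcongr
  · have h1 : (t ^ 2)⁻¹ < 1 := inv_lt_one_of_one_lt₀ (one_lt_pow₀ ht two_ne_zero)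
    have h := (tendsto_eval_Ppoly_div_pow ht).inv₀ (by rw [ne_eq, inv_eq_zero]; linarith)
    simpa using h

lemma integral_cos_nat_mul {m : ℕ} (hm : m ≠ 0) :
    ∫ θ in (0 : ℝ)..Real.pi, Real.cos (m * θ) = 0 := by
  have hm' : (m : ℝ) ≠ 0 := Nat.cast_ne_zero.2 hm
  rw [intervalIntegral.integral_comp_mul_left (fun x => Real.cos x) hm']
  simp [Real.sin_nat_mul_pi]

lemma integral_Ppoly_mul_sqrt (n : ℕ) :
    ∫ y in (-2 : ℝ)..2, (Ppoly n).eval y * √(4 - y ^ 2) =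
      if n = 0 then 2 * Real.pi else 0 := by
  have hsub := intervalIntegral.integral_comp_mul_deriv (a := 0) (b := Real.pi)
    (f := fun θ => 2 * Real.cos θ) (f' := fun θ => 2 * (-Real.sin θ))
    (g := fun y => (Ppoly n).eval y * √(4 - y ^ 2))
    (fun θ _ => (Real.hasDerivAt_cos θ).const_mul 2) (by fun_prop)
    (by fun_prop)
  simp only [Real.cos_zero, Real.cos_pi, Function.comp_def] at hsub
  rw [intervalIntegral.integral_symm, show (-2 : ℝ) = 2 * -1 by norm_num]
  nth_rewrite 1 [show (2 : ℝ) = 2 * 1 by norm_num]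
  rw [← hsub, ← intervalIntegral.integral_neg]
  have e : ∫ θ in (0 : ℝ)..Real.pi, -((Ppoly n).eval (2 * Real.cos θ) *
        √(4 - (2 * Real.cos θ) ^ 2) * (2 * -Real.sin θ)) =
      ∫ θ in (0 : ℝ)..Real.pi, 2 * (Real.cos (n * θ) - Real.cos ((n + 2 : ℕ) * θ)) := by
    refine intervalIntegral.integral_congr fun θ hθ => ?_
    rw [Set.uIcc_of_le Real.pi_pos.le] at hθ
    have hs := Real.sin_nonneg_of_mem_Icc hθ
    have hr : √(4 - (2 * Real.cos θ) ^ 2) = 2 * Real.sin θ := by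
      rw [show 4 - (2 * Real.cos θ) ^ 2 = (2 * Real.sin θ) ^ 2 by
        linear_combination -4 * Real.sin_sq_add_cos_sq θ, Real.sqrt_sq (by positivity)]
    have h := eval_Ppoly_two_cos_mul_sin n θ
    have e1 : (n : ℝ) * θ = (n + 1) * θ - θ := by ring
    have e2 : ((n + 2 : ℕ) : ℝ) * θ = (n + 1) * θ + θ := by push_cast; ring
    simp only [hr]
    rw [e1, e2, Real.cos_sub, Real.cos_add, ← h]
    ring
  rw [e, intervalIntegral.integral_const_mul, intervalIntegral.integral_sub
    (by apply Continuous.intervalIntegrable; fun_prop)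
    (by apply Continuous.intervalIntegrable; fun_prop), integral_cos_nat_mul (m := n + 2) (by omega)]
  split_ifs with hn
  · simp [hn]
  · rw [integral_cos_nat_mul hn]; simp

lemma Continuous.integrable_of_compl_null {μ : Measure ℝ} [IsFiniteMeasure μ] {K : Set ℝ}
    (hK : IsCompact K) (hμ : μ Kᶜ = 0) {f : ℝ → ℝ} (hf : Continuous f) : Integrable f μ := by
  have h := hf.continuousOn.integrableOn_compact (μ := μ) hK
  rwa [IntegrableOn, Measure.restrict_eq_self_of_ae_mem (mem_ae_iff.2 hμ)] at h

lemma measure_eq_of_integral_polynomial_eq {μ ν : Measure ℝ} [IsFiniteMeasure μ]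
    [IsFiniteMeasure ν] {K : Set ℝ} (hK : IsCompact K) (hμ : μ Kᶜ = 0) (hν : ν Kᶜ = 0)
    (h : ∀ p : ℝ[X], ∫ x, p.eval x ∂μ = ∫ x, p.eval x ∂ν) : μ = ν := by
  obtain ⟨a, ha⟩ := hK.bddBelow
  obtain ⟨b, hb⟩ := hK.bddAbove
  refine ext_of_forall_integral_eq_of_IsFiniteMeasure fun f => ?_
  have approx : ∀ ρ : Measure ℝ, IsFiniteMeasure ρ → ρ Kᶜ = 0 → ∀ ε > 0, ∀ p : ℝ[X],
      (∀ x ∈ Set.Icc a b, |p.eval x - f x| < ε) →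
      |(∫ x, p.eval x ∂ρ) - ∫ x, f x ∂ρ| ≤ ε * ρ.real Set.univ := by
    intro ρ _ hρ ε _ p hp
    rw [← integral_sub (p.continuous.integrable_of_compl_null hK hρ)
      (f.continuous.integrable_of_compl_null hK hρ)]
    have hle : ∀ᵐ x ∂ρ, ‖p.eval x - f x‖ ≤ ε := by
      filter_upwards [mem_ae_iff.2 hρ] with x hx
      exact (hp x ⟨ha hx, hb hx⟩).le
    exact norm_integral_le_of_norm_le_const hle
  have key : ∀ ε > 0, |(∫ x, f x ∂μ) - ∫ x, f x ∂ν| ≤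
      ε * (μ.real Set.univ + ν.real Set.univ) := by
    intro ε hε
    obtain ⟨p, hp⟩ := exists_polynomial_near_of_continuousOn a b f f.continuous.continuousOn ε hε
    have h1 := abs_le.1 (approx μ inferInstance hμ ε hε p hp)
    have h2 := abs_le.1 (approx ν inferInstance hν ε hε p hp)
    rw [h p] at h1
    rw [abs_le]
    constructor <;> linarith [h1.1, h1.2, h2.1, h2.2]
  have lim : Tendsto (fun ε : ℝ => ε * (μ.real Set.univ + ν.real Set.univ))
      (nhdsWithin 0 (Set.Ioi 0)) (nhds 0) := by
    have : Continuous fun ε : ℝ => ε * (μ.real Set.univ + ν.real Set.univ) := by fun_prop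
    simpa using (this.tendsto 0).mono_left nhdsWithin_le_nhds
  have := ge_of_tendsto lim (by filter_upwards [self_mem_nhdsWithin] with ε hε using key ε hε)
  exact sub_eq_zero.1 (abs_nonpos_iff.1 this)

lemma linearMap_ext_Ppoly_comp {a : ℝ} {Λ₁ Λ₂ : ℝ[X] →ₗ[ℝ] ℝ}
    (h : ∀ n, Λ₁ ((Ppoly n).comp (X - C a)) = Λ₂ ((Ppoly n).comp (X - C a))) : Λ₁ = Λ₂ := by
  have key : ∀ j n, Λ₁ (X ^ j * (Ppoly n).comp (X - C a)) =
      Λ₂ (X ^ j * (Ppoly n).comp (X - C a)) := by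
    intro j
    induction j with
    | zero => simpa using h
    | succ j ih =>
      intro n
      cases n with
      | zero =>
        have e : X ^ (j + 1) * (Ppoly 0).comp (X - C a) =
            X ^ j * (Ppoly 1).comp (X - C a) + a • (X ^ j * (Ppoly 0).comp (X - C a)) := by
          simp [Ppoly, smul_eq_C_mul]; ring
        rw [e, map_add, map_add, map_smul, map_smul, ih, ih]
      | succ n =>
        have e : X ^ (j + 1) * (Ppoly (n + 1)).comp (X - C a) =
            X ^ j * (Ppoly (n + 2)).comp (X - C a) + X ^ j * (Ppoly n).comp (X - C a)
              + a • (X ^ j * (Ppoly (n + 1)).comp (X - C a)) := by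
          simp [Ppoly, smul_eq_C_mul]; ring
        rw [e, map_add, map_add, map_add, map_add, map_smul, map_smul, ih, ih, ih]
  refine Polynomial.lhom_ext' fun n => LinearMap.ext_ring ?_
  have := key n 0
  simpa [Ppoly, X_pow_eq_monomial] using this

/-- The density of the semicircle law centred at `√s`. -/
noncomputable def semicircleDensity (s : ℕ) (x : ℝ) : ℝ :=
  √(4 - (x - √s) ^ 2) / (2 * Real.pi)

lemma continuous_semicircleDensity (s : ℕ) : Continuous (semicircleDensity s) := by
  unfold semicircleDensity; fun_prop

lemma semicircleDensity_nonneg (s : ℕ) (x : ℝ) : 0 ≤ semicircleDensity s x := by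
  have := Real.pi_pos
  unfold semicircleDensity; positivity

lemma semicircleDensity_eq_zero {s : ℕ} {x : ℝ} (hx : 2 ≤ |x - √s|) :
    semicircleDensity s x = 0 := by
  have : 2 ^ 2 ≤ |x - √s| ^ 2 := by gcongr
  rw [sq_abs] at this
  rw [semicircleDensity, Real.sqrt_eq_zero_of_nonpos (by linarith), zero_div]

lemma integrable_mul_semicircleDensity (s : ℕ) {f : ℝ → ℝ} (hf : Continuous f) :
    Integrable fun x => f x * semicircleDensity s x := by
  refine (hf.mul (continuous_semicircleDensity s)).integrable_of_hasCompactSupport ?_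
  refine HasCompactSupport.intro (isCompact_Icc (a := √s - 2) (b := √s + 2)) fun x hx => ?_
  rw [Pi.mul_apply, semicircleDensity_eq_zero, mul_zero]
  by_contra! h
  have := abs_lt.1 h
  exact hx ⟨by linarith, by linarith⟩

lemma integral_Ppoly_mul_semicircleDensity (s n : ℕ) :
    ∫ x, (Ppoly n).eval (x - √s) * semicircleDensity s x = if n = 0 then 1 else 0 := by
  have h1 := integral_sub_right_eq_self (μ := volume)
    (fun y : ℝ => (Ppoly n).eval y * (√(4 - y ^ 2) / (2 * Real.pi))) √s
  simp only [semicircleDensity]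
  rw [h1]
  have h2 : ∫ y in Set.Ioc (-2 : ℝ) 2, (Ppoly n).eval y * (√(4 - y ^ 2) / (2 * Real.pi)) =
      ∫ y, (Ppoly n).eval y * (√(4 - y ^ 2) / (2 * Real.pi)) := by
    refine setIntegral_eq_integral_of_forall_compl_eq_zero fun y hy => ?_
    rw [Real.sqrt_eq_zero_of_nonpos, zero_div, mul_zero]
    by_contra! h
    exact hy ⟨by nlinarith, by nlinarith⟩
  rw [← h2, ← intervalIntegral.integral_of_le (by norm_num)]
  simp only [← mul_div_assoc]
  rw [intervalIntegral.integral_div, integral_Ppoly_mul_sqrt]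
  have := Real.pi_ne_zero
  split_ifs <;> simp

/-- The location `e^c + e^{-c} + √s` of the pole of `f_c`. -/
noncomputable def fcPole (s : ℕ) (c : ℝ) : ℝ := Real.exp c + Real.exp (-c) + √s

lemma two_add_sqrt_le_fcPole (s : ℕ) (c : ℝ) : 2 + √s ≤ fcPole s c := by
  have := two_le_add_inv (Real.exp_pos c)
  rw [fcPole, Real.exp_neg]; linarith

lemma integral_Qpoly_mul_sub {s : ℕ} {c : ℝ} {μ : Measure ℝ}
    (hint : ∀ f : ℝ → ℝ, Continuous f → Integrable f μ)
    (hmom : ∀ n : ℕ, ∫ x, (Qpoly s n).eval x ∂μ = Real.exp (-(c * n))) (n : ℕ) :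
    ∫ x, (Qpoly s n).eval x * (fcPole s c - x) ∂μ =
      if n = 0 then Real.exp c + √s else 0 := by
  have hr : ∀ n : ℕ, ∫ x, (Qpoly s n).eval x ∂μ = Real.exp (-c) ^ n := by
    intro n
    rw [hmom, ← Real.exp_nat_mul]
    ring_nf
  have hQ : ∀ n, Integrable (fun x => (Qpoly s n).eval x) μ := fun n => hint _ (by fun_prop)
  cases n with
  | zero =>
    have e : ∀ x, (Qpoly s 0).eval x * (fcPole s c - x) =
        fcPole s c * (Qpoly s 0).eval x - (Qpoly s 1).eval x := fun x => by
      simp [Qpoly]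
    simp only [e]
    rw [integral_sub ((hQ 0).const_mul _) (hQ 1), integral_const_mul, hr, hr, fcPole]
    simp
    ring
  | succ n =>
    have e : ∀ x, (Qpoly s (n + 1)).eval x * (fcPole s c - x) =
        (fcPole s c - √s) * (Qpoly s (n + 1)).eval x -
          ((Qpoly s (n + 2)).eval x + (Qpoly s n).eval x) := fun x => by
      simp [Qpoly]; ring
    simp only [e]
    rw [integral_sub ((hQ _).const_mul _) (hint _ (by fun_prop)), integral_const_mul,
      integral_add (hQ _) (hQ _), hr, hr, hr, fcPole]
    have h1 : Real.exp c * Real.exp (-c) = 1 := by rw [← Real.exp_add]; simp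
    rw [if_neg n.succ_ne_zero]
    linear_combination Real.exp (-c) ^ n * h1

lemma integral_Ppoly_mul_sub {s : ℕ} {c : ℝ} {μ : Measure ℝ}
    (hint : ∀ f : ℝ → ℝ, Continuous f → Integrable f μ)
    (hmom : ∀ n : ℕ, ∫ x, (Qpoly s n).eval x ∂μ = Real.exp (-(c * n))) (n : ℕ) :
    ∫ x, (Ppoly n).eval (x - √s) * (fcPole s c - x) ∂μ =
      (Real.exp c + √s) * (-√s) ^ n := by
  induction n with
  | zero => simpa [Ppoly, Qpoly] using integral_Qpoly_mul_sub hint hmom 0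
  | succ n ih =>
    have e : ∀ x, (Ppoly (n + 1)).eval (x - √s) * (fcPole s c - x) =
        (Qpoly s (n + 1)).eval x * (fcPole s c - x) -
          √s * ((Ppoly n).eval (x - √s) * (fcPole s c - x)) := fun x => by
      rw [eval_Qpoly_succ]; ring
    simp only [e]
    rw [integral_sub (hint _ (by fun_prop)) (hint _ (by fun_prop)), integral_const_mul, ih,
      integral_Qpoly_mul_sub hint hmom, if_neg n.succ_ne_zero]
    ring

/-- The linear functional `p ↦ ∫ p g dμ` on polynomials. -/
noncomputable def integralMap (μ : Measure ℝ) (g : ℝ → ℝ)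
    (h : ∀ p : ℝ[X], Integrable (fun x => p.eval x * g x) μ) : ℝ[X] →ₗ[ℝ] ℝ where
  toFun p := ∫ x, p.eval x * g x ∂μ
  map_add' p q := by
    simp only [eval_add, add_mul]
    exact integral_add (h p) (h q)
  map_smul' a p := by
    simp only [eval_smul, smul_eq_mul, mul_assoc, RingHom.id_apply]
    exact integral_const_mul _ _

lemma integral_polynomial_mul {s : ℕ} {c : ℝ} {μ : Measure ℝ}
    (hint : ∀ f : ℝ → ℝ, Continuous f → Integrable f μ)
    (hmom : ∀ n : ℕ, ∫ x, (Qpoly s n).eval x ∂μ = Real.exp (-(c * n))) (p : ℝ[X]) :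
    ∫ x, p.eval x * ((fcPole s c - x) * (1 + √s * x)) ∂μ =
      ∫ x, p.eval x * ((Real.exp c + √s) * semicircleDensity s x) := by
  have h1 : ∀ p : ℝ[X],
      Integrable (fun x => p.eval x * ((fcPole s c - x) * (1 + √s * x))) μ :=
    fun p => hint _ (by fun_prop)
  have h2 : ∀ p : ℝ[X],
      Integrable (fun x => p.eval x * ((Real.exp c + √s) * semicircleDensity s x)) := by
    intro p
    simp only [← mul_assoc]
    exact integrable_mul_semicircleDensity s (by fun_prop)
  suffices integralMap μ _ h1 = integralMap volume _ h2 from LinearMap.congr_fun this p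
  refine linearMap_ext_Ppoly_comp (a := √s) fun n => ?_
  change ∫ x, _ ∂μ = ∫ x, _
  have hc : ∀ x, ((Ppoly n).comp (X - C √s)).eval x = (Ppoly n).eval (x - √s) := by simp
  simp only [hc, mul_left_comm _ (Real.exp c + √s)]
  rw [integral_const_mul, integral_Ppoly_mul_semicircleDensity]
  have hL := integral_Ppoly_mul_sub hint hmom
  cases n with
  | zero =>
    have e : ∀ x, (Ppoly 0).eval (x - √s) * ((fcPole s c - x) * (1 + √s * x)) =
        (1 + √s ^ 2) * ((Ppoly 0).eval (x - √s) * (fcPole s c - x)) +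
          √s * ((Ppoly 1).eval (x - √s) * (fcPole s c - x)) := fun x => by
      rw [eval_Ppoly_zero, eval_Ppoly_one]; ring
    simp only [e]
    rw [integral_add (hint _ (by fun_prop)) (hint _ (by fun_prop)), integral_const_mul,
      integral_const_mul, hL, hL, if_pos trivial]
    ring
  | succ n =>
    have e : ∀ x, (Ppoly (n + 1)).eval (x - √s) * ((fcPole s c - x) * (1 + √s * x)) =
        (1 + √s ^ 2) * ((Ppoly (n + 1)).eval (x - √s) * (fcPole s c - x)) +
          √s * ((Ppoly (n + 2)).eval (x - √s) * (fcPole s c - x) +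
            (Ppoly n).eval (x - √s) * (fcPole s c - x)) := fun x => by
      rw [eval_Ppoly_add_two]; ring
    simp only [e]
    rw [integral_add (hint _ (by fun_prop)) (hint _ (by fun_prop)), integral_const_mul,
      integral_const_mul, integral_add (hint _ (by fun_prop)) (hint _ (by fun_prop)),
      hL, hL, hL, if_neg n.succ_ne_zero]
    ring

lemma one_le_sqrt_natCast {s : ℕ} (hs : 1 ≤ s) : 1 ≤ √(s : ℝ) :=
  Real.one_le_sqrt.2 (by exact_mod_cast hs)

lemma one_add_sqrt_mul_nonneg {s : ℕ} {x : ℝ} (hx : √s - 2 ≤ x) : 0 ≤ 1 + √s * x := by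
  nlinarith [sq_nonneg (√(s : ℝ) - 1), mul_le_mul_of_nonneg_left hx (Real.sqrt_nonneg (s : ℝ))]

lemma mul_semicircleDensity_nonneg (s : ℕ) (c x : ℝ) :
    0 ≤ (fcPole s c - x) * (1 + √s * x) * ((Real.exp c + √s) * semicircleDensity s x) := by
  rcases le_or_gt 2 |x - √s| with h | h
  · simp [semicircleDensity_eq_zero h]
  · have h' := abs_lt.1 h
    have h1 := two_add_sqrt_le_fcPole s c
    have h2 : 0 ≤ 1 + √s * x := one_add_sqrt_mul_nonneg (by linarith)
    have h3 : 0 ≤ fcPole s c - x := by linarith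
    have h4 := semicircleDensity_nonneg s x
    positivity

lemma withDensity_sq_eq {s : ℕ} {c : ℝ} {μ : Measure ℝ} [IsProbabilityMeasure μ]
    {K : Set ℝ} (hK : IsCompact K) (hμ : μ Kᶜ = 0)
    (hmom : ∀ n : ℕ, ∫ x, (Qpoly s n).eval x ∂μ = Real.exp (-(c * n))) :
    μ.withDensity (fun x => ENNReal.ofReal (((fcPole s c - x) * (1 + √s * x)) ^ 2)) =
      volume.withDensity (fun x => ENNReal.ofReal
        ((fcPole s c - x) * (1 + √s * x) *
          ((Real.exp c + √s) * semicircleDensity s x))) := by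
  have hint : ∀ f : ℝ → ℝ, Continuous f → Integrable f μ :=
    fun f hf => hf.integrable_of_compl_null hK hμ
  have hd := continuous_semicircleDensity s
  have fin₁ : IsFiniteMeasure (μ.withDensity
      (fun x => ENNReal.ofReal (((fcPole s c - x) * (1 + √s * x)) ^ 2))) :=
    isFiniteMeasure_withDensity_ofReal (hint _ (by fun_prop)).2
  have fin₂ : IsFiniteMeasure ((volume : Measure ℝ).withDensity (fun x => ENNReal.ofReal
        ((fcPole s c - x) * (1 + √s * x) *
          ((Real.exp c + √s) * semicircleDensity s x)))) := by
    refine isFiniteMeasure_withDensity_ofReal (Integrable.hasFiniteIntegral ?_)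
    simp only [← mul_assoc]
    exact integrable_mul_semicircleDensity s (by fun_prop)
  refine measure_eq_of_integral_polynomial_eq
    (hK.union (isCompact_Icc (a := √s - 2) (b := √s + 2))) ?_ ?_ fun p => ?_
  · refine withDensity_absolutelyContinuous _ _ (measure_mono_null ?_ hμ)
    exact Set.compl_subset_compl.2 Set.subset_union_left
  · refine measure_mono_null (Set.compl_subset_compl.2 Set.subset_union_right) ?_
    rw [withDensity_apply _ measurableSet_Icc.compl]
    refine setLIntegral_eq_zero measurableSet_Icc.compl fun x hx => ?_
    rw [semicircleDensity_eq_zero]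
    · simp
    · by_contra! h
      have := abs_lt.1 h
      exact hx ⟨by linarith, by linarith⟩
  · rw [integral_withDensity_eq_integral_toReal_smul (by fun_prop) (by simp),
      integral_withDensity_eq_integral_toReal_smul (by fun_prop) (by simp)]
    have := integral_polynomial_mul hint hmom (p * ((C (fcPole s c) - X) * (1 + C √s * X)))
    simp only [ENNReal.toReal_ofReal (sq_nonneg _),
      ENNReal.toReal_ofReal (mul_semicircleDensity_nonneg s c _), smul_eq_mul]
    convert! this using 1
    · congr 1; ext x; simp; ring
    · congr 1; ext x; simp; ring

lemma restrict_compl_atoms_eq {s : ℕ} (hs : 1 ≤ s) {c : ℝ} {μ : Measure ℝ}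
    [IsProbabilityMeasure μ] {K : Set ℝ} (hK : IsCompact K) (hμ : μ Kᶜ = 0)
    (hmom : ∀ n : ℕ, ∫ x, (Qpoly s n).eval x ∂μ = Real.exp (-(c * n))) :
    μ.restrict {-1 / √s, fcPole s c}ᶜ = volume.withDensity ((fun x => ENNReal.ofReal
      (if |x - √s| ≤ 2 then nuDensity s x else 0)) * fun x => ENNReal.ofReal (fc s c x)) := by
  have hσ := one_le_sqrt_natCast hs
  have hd := continuous_semicircleDensity s
  have hE : MeasurableSet ({-1 / √s, fcPole s c}ᶜ : Set ℝ) :=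
    ((Set.finite_singleton _).insert _).measurableSet.compl
  have hne : ∀ x ∈ ({-1 / √s, fcPole s c}ᶜ : Set ℝ),
      fcPole s c - x ≠ 0 ∧ 1 + √s * x ≠ 0 := by
    intro x hx
    simp only [Set.mem_compl_iff, Set.mem_insert_iff, Set.mem_singleton_iff, not_or] at hx
    refine ⟨sub_ne_zero.2 (Ne.symm hx.2), fun h => hx.1 ?_⟩
    rw [eq_div_iff (by positivity)]
    linarith
  have hvol : (volume : Measure ℝ).restrict {-1 / √s, fcPole s c}ᶜ = volume := by
    refine Measure.restrict_eq_self_of_ae_mem (compl_mem_ae_iff.2 ?_)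
    exact ((Set.finite_singleton _).insert _).measure_zero _
  have hinv := withDensity_inv_same (μ := μ.restrict {-1 / √s, fcPole s c}ᶜ)
    (f := fun x => ENNReal.ofReal (((fcPole s c - x) * (1 + √s * x)) ^ 2))
    (by fun_prop) (by
      filter_upwards [ae_restrict_mem hE] with x hx
      have := hne x hx
      rw [ne_eq, ENNReal.ofReal_eq_zero, not_le]
      exact sq_pos_of_ne_zero (mul_ne_zero this.1 this.2)) (by simp)
  rw [← hinv, ← restrict_withDensity hE, withDensity_sq_eq hK hμ hmom,
    restrict_withDensity hE, hvol, ← withDensity_mul _ (by fun_prop) (by fun_prop)]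
  refine withDensity_congr_ae ?_
  rw [← hvol]
  filter_upwards [ae_restrict_mem hE] with x hx
  obtain ⟨h1, h2⟩ := hne x hx
  have h2' : x * √s + 1 ≠ 0 := by rwa [add_comm, mul_comm]
  simp only [Pi.mul_apply]
  rw [← ENNReal.ofReal_inv_of_pos (sq_pos_of_ne_zero (mul_ne_zero h1 h2)),
    ← ENNReal.ofReal_mul (mul_semicircleDensity_nonneg s c x)]
  split_ifs with hx2
  · have hx2' := abs_le.1 hx2
    have h3 : 0 ≤ x * √s + 1 := by
      rw [add_comm, mul_comm]; exact one_add_sqrt_mul_nonneg (by linarith)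
    have hpi := Real.pi_pos
    rw [← ENNReal.ofReal_mul (by rw [nuDensity]; positivity)]
    congr 1
    have h1' : Real.exp c + Real.exp (-c) + √s - x ≠ 0 := h1
    rw [nuDensity, fc, semicircleDensity, fcPole, show 1 + √s * x = x * √s + 1 by ring]
    field_simp
  · rw [semicircleDensity_eq_zero (le_of_not_ge hx2)]
    simp

lemma ae_mem_atoms_or_abs_sub_lt {s : ℕ} (hs : 1 ≤ s) {c : ℝ} {μ : Measure ℝ}
    [IsProbabilityMeasure μ] {K : Set ℝ} (hK : IsCompact K) (hμ : μ Kᶜ = 0)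
    (hmom : ∀ n : ℕ, ∫ x, (Qpoly s n).eval x ∂μ = Real.exp (-(c * n))) :
    ∀ᵐ x ∂μ, x = -1 / √s ∨ x = fcPole s c ∨ |x - √s| < 2 := by
  have hE : MeasurableSet ({-1 / √s, fcPole s c}ᶜ : Set ℝ) :=
    ((Set.finite_singleton _).insert _).measurableSet.compl
  have h : ∀ᵐ x ∂(μ.restrict {-1 / √s, fcPole s c}ᶜ), |x - √s| < 2 := by
    rw [restrict_compl_atoms_eq hs hK hμ hmom]
    have hm : Measurable ((fun x => ENNReal.ofReal
        (if |x - √s| ≤ 2 then nuDensity s x else 0)) * fun x => ENNReal.ofReal (fc s c x)) := by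
      unfold nuDensity fc
      refine Measurable.mul (Measurable.ennreal_ofReal (Measurable.ite ?_ ?_ ?_)) ?_
      · exact measurableSet_le (by fun_prop) (by fun_prop)
      all_goals fun_prop
    rw [ae_withDensity_iff hm]
    refine ae_of_all _ fun x hx => ?_
    by_contra! h
    refine hx ?_
    have : 2 ^ 2 ≤ |x - √s| ^ 2 := by gcongr
    rw [sq_abs] at this
    simp [nuDensity, Real.sqrt_eq_zero_of_nonpos (show 4 - (x - √s) ^ 2 ≤ 0 by linarith)]
  rw [ae_restrict_iff' hE] at h
  filter_upwards [h] with x hx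
  by_contra! h'
  exact absurd (hx (by simp [h'.1, h'.2.1])) (not_lt.2 h'.2.2)

lemma tendsto_div_zero_of_abs_le {a D : ℕ → ℝ} {M : ℝ} (ha : ∀ n, |a n| ≤ M)
    (hD : ∀ n : ℕ, (n : ℝ) + 1 ≤ |D n|) : Tendsto (fun n => a n / D n) atTop (nhds 0) := by
  have h := tendsto_one_div_add_atTop_nhds_zero_nat.const_mul M
  rw [mul_zero] at h
  refine squeeze_zero_norm (fun n => ?_) h
  rw [Real.norm_eq_abs, abs_div, mul_one_div]
  have := hD n
  have := (abs_nonneg _).trans (ha n)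
  gcongr
  exact ha n

lemma eval_Qpoly_neg_inv {s : ℕ} (hs : 1 ≤ s) (n : ℕ) :
    (Qpoly s n).eval (-1 / √s) = (-1 / √s) ^ n := by
  have hσ := one_le_sqrt_natCast hs
  induction n using Nat.twoStepInduction with
  | zero => simp [Qpoly]
  | one => simp [Qpoly]
  | more n h1 h2 =>
    simp only [Qpoly, eval_sub, eval_mul, eval_X, eval_C, h1, h2, pow_succ]
    field_simp
    ring

lemma neg_inv_lt_fcPole (s : ℕ) (c : ℝ) : -1 / √s < fcPole s c := by
  have h1 := two_add_sqrt_le_fcPole s c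
  have h2 : -1 / √(s : ℝ) ≤ 0 := div_nonpos_of_nonpos_of_nonneg (by norm_num) (by positivity)
  linarith [Real.sqrt_nonneg (s : ℝ)]

lemma measureReal_neg_inv {s : ℕ} (hs : 1 ≤ s) {c : ℝ} {μ : Measure ℝ}
    [IsProbabilityMeasure μ] {K : Set ℝ} (hK : IsCompact K) (hμ : μ Kᶜ = 0)
    (hmom : ∀ n : ℕ, ∫ x, (Qpoly s n).eval x ∂μ = Real.exp (-(c * n))) :
    μ.real {-1 / √s} = (1 - 1 / s) * fc s c (-1 / √s) := by
  have hint : ∀ f : ℝ → ℝ, Continuous f → Integrable f μ :=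
    fun f hf => hf.integrable_of_compl_null hK hμ
  have hσ := one_le_sqrt_natCast hs
  have hq := neg_inv_lt_fcPole s c
  have hy : -1 / √s - √s = -(√s + (√s)⁻¹) := by ring
  have hP : ∀ n : ℕ, (n : ℝ) + 1 ≤ |(Ppoly n).eval (-1 / √s - √s)| := by
    intro n
    rw [hy, eval_Ppoly_neg, abs_mul, abs_neg_one_pow, one_mul]
    exact (add_one_le_eval_Ppoly n (two_le_add_inv (by linarith))).trans (le_abs_self _)
  have hP0 : ∀ n : ℕ, 0 < |(Ppoly n).eval (-1 / √s - √s)| :=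
    fun n => lt_of_lt_of_le (by positivity) (hP n)
  have hlim : Tendsto (fun n => ∫ x, (Ppoly n).eval (x - √s) /
      (Ppoly n).eval (-1 / √s - √s) * (fcPole s c - x) ∂μ) atTop
      (nhds (∫ x, ({-1 / √s} : Set ℝ).indicator (fun _ => fcPole s c - -1 / √s) x ∂μ)) := by
    refine tendsto_integral_of_dominated_convergence (fun x => |fcPole s c - x|)
      (fun n => (by fun_prop : Continuous _).aestronglyMeasurable) (hint _ (by fun_prop)) ?_ ?_
    · intro n
      filter_upwards [ae_mem_atoms_or_abs_sub_lt hs hK hμ hmom] with x hx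
      rw [Real.norm_eq_abs, abs_mul, abs_div]
      rcases hx with rfl | rfl | hx
      · rw [div_self (hP0 n).ne', one_mul]
      · simp
      · refine mul_le_of_le_one_left (abs_nonneg _) ((div_le_one (hP0 n)).2 ?_)
        exact (abs_eval_Ppoly_le n hx.le).trans (hP n)
    · filter_upwards [ae_mem_atoms_or_abs_sub_lt hs hK hμ hmom] with x hx
      by_cases hxq : x = -1 / √s
      · subst hxq
        simp only [Set.mem_singleton_iff, Set.indicator_of_mem]
        refine tendsto_const_nhds.congr fun n => ?_
        rw [div_self (abs_pos.1 (hP0 n)), one_mul]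
      · rw [Set.indicator_of_notMem (by simpa using hxq)]
        rcases hx with hx | rfl | hx
        · exact absurd hx hxq
        · simp
        · obtain ⟨M, hM⟩ := exists_abs_eval_Ppoly_le hx
          simpa using (tendsto_div_zero_of_abs_le hM hP).mul_const (fcPole s c - x)
  rw [integral_indicator_const _ (measurableSet_singleton _), smul_eq_mul] at hlim
  have hlim' : Tendsto (fun n => ∫ x, (Ppoly n).eval (x - √s) /
      (Ppoly n).eval (-1 / √s - √s) * (fcPole s c - x) ∂μ) atTop
      (nhds ((Real.exp c + √s) * (1 - (√s ^ 2)⁻¹))) := by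
    refine ((tendsto_pow_div_eval_Ppoly hσ).const_mul (Real.exp c + √s)).congr fun n => ?_
    simp only [div_mul_eq_mul_div]
    rw [integral_div, integral_Ppoly_mul_sub hint hmom, hy, eval_Ppoly_neg, neg_pow,
      mul_left_comm, mul_div_mul_left _ _ (pow_ne_zero n (by norm_num)), mul_div_assoc]
  have h := tendsto_nhds_unique hlim hlim'
  rw [Real.sq_sqrt (Nat.cast_nonneg s), ← one_div] at h
  have hf : fc s c (-1 / √s) = (Real.exp c + √s) / (fcPole s c - -1 / √s) := rfl
  rw [hf, ← mul_div_assoc, eq_div_iff (sub_pos.2 hq).ne', h, mul_comm]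

lemma add_one_le_eval_Qpoly_fcPole (s : ℕ) (c : ℝ) (n : ℕ) :
    ((n + 1 : ℕ) : ℝ) + 1 + √s * (n + 1) ≤ (Qpoly s (n + 1)).eval (fcPole s c) := by
  rw [eval_Qpoly_succ]
  have h : 2 ≤ fcPole s c - √s := by linarith [two_add_sqrt_le_fcPole s c]
  gcongr
  · exact add_one_le_eval_Ppoly (n + 1) h
  · exact add_one_le_eval_Ppoly n h

lemma tendsto_exp_div_eval_Qpoly_fcPole (s : ℕ) (c : ℝ) :
    Tendsto (fun n : ℕ => Real.exp (-(c * (n + 1 : ℕ))) / (Qpoly s (n + 1)).eval (fcPole s c))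
      atTop (nhds (if c < 0 then
        (Real.exp (-c) - Real.exp c) / (Real.exp (-c) + √s) else 0)) := by
  split_ifs with hc
  · have hT : 1 < Real.exp (-c) := Real.one_lt_exp_iff.2 (by linarith)
    have he : ∀ n : ℕ, Real.exp (-(c * n)) = Real.exp (-c) ^ n := fun n => by
      rw [← Real.exp_nat_mul]; ring_nf
    have hw : fcPole s c - √s = Real.exp (-c) + (Real.exp (-c))⁻¹ := by
      rw [fcPole, ← Real.exp_neg, neg_neg]; ring
    have hci : Real.exp c = (Real.exp (-c))⁻¹ := by rw [← Real.exp_neg, neg_neg]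
    simp only [he, hci]
    simp only [eval_Qpoly_succ, hw]
    generalize Real.exp (-c) = T at hT
    have hT0 : 0 < T := by linarith
    have hσ := Real.sqrt_nonneg (s : ℝ)
    have h := tendsto_eval_Ppoly_div_pow hT
    have h' := ((tendsto_add_atTop_iff_nat 1).2 h).add (h.const_mul (√s / T))
    have h1 : (T ^ 2)⁻¹ < 1 := inv_lt_one_of_one_lt₀ (one_lt_pow₀ hT two_ne_zero)
    have h2 : 0 < (1 - (T ^ 2)⁻¹)⁻¹ := inv_pos.2 (by linarith)
    have h3 := h'.inv₀ (by positivity)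
    have h5 : T ^ 2 - 1 ≠ 0 := by nlinarith
    have e : ((1 - (T ^ 2)⁻¹)⁻¹ + √s / T * (1 - (T ^ 2)⁻¹)⁻¹)⁻¹ = (T - T⁻¹) / (T + √s) := by
      have e1 : 1 - (T ^ 2)⁻¹ = (T ^ 2 - 1) / T ^ 2 := by field_simp
      rw [e1]
      field_simp
    rw [e] at h3
    refine h3.congr fun n => ?_
    rw [← inv_div (_ + _) (T ^ (n + 1)), pow_succ]
    congr 1
    field_simp
  · have hD : ∀ n : ℕ, (n : ℝ) + 1 ≤ |(Qpoly s (n + 1)).eval (fcPole s c)| := by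
      intro n
      refine le_trans ?_ ((add_one_le_eval_Qpoly_fcPole s c n).trans (le_abs_self _))
      have : 0 ≤ √s * ((n : ℝ) + 1) := by positivity
      push_cast
      linarith
    refine tendsto_div_zero_of_abs_le (M := 1) (fun n => ?_) hD
    rw [abs_of_pos (Real.exp_pos _), Real.exp_le_one_iff, neg_nonpos]
    exact mul_nonneg (not_lt.1 hc) (Nat.cast_nonneg _)

lemma measureReal_fcPole {s : ℕ} (hs : 1 ≤ s) {c : ℝ} {μ : Measure ℝ}
    [IsProbabilityMeasure μ] {K : Set ℝ} (hK : IsCompact K) (hμ : μ Kᶜ = 0)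
    (hmom : ∀ n : ℕ, ∫ x, (Qpoly s n).eval x ∂μ = Real.exp (-(c * n))) :
    μ.real {fcPole s c} = if c < 0 then
      (Real.exp (-c) - Real.exp c) / (Real.exp (-c) + √s) else 0 := by
  have hσ := one_le_sqrt_natCast hs
  have hQ := add_one_le_eval_Qpoly_fcPole s c
  have hQ1 : ∀ n : ℕ, (n : ℝ) + 1 ≤ |(Qpoly s (n + 1)).eval (fcPole s c)| := by
    intro n
    refine le_trans ?_ ((hQ n).trans (le_abs_self _))
    have : 0 ≤ √s * ((n : ℝ) + 1) := by positivity
    push_cast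
    linarith
  have hQ0 : ∀ n, 0 < |(Qpoly s (n + 1)).eval (fcPole s c)| :=
    fun n => lt_of_lt_of_le (by positivity) (hQ1 n)
  have hq : ∀ n, |(Qpoly s (n + 1)).eval (-1 / √s)| ≤ 1 := by
    intro n
    rw [eval_Qpoly_neg_inv hs, abs_pow]
    refine pow_le_one₀ (abs_nonneg _) ?_
    rw [abs_div, abs_neg, abs_one, abs_of_pos (by linarith), div_le_one (by linarith)]
    exact hσ
  have hin : ∀ x, |x - √s| < 2 → ∀ n,
      |(Qpoly s (n + 1)).eval x| ≤ |(Qpoly s (n + 1)).eval (fcPole s c)| := by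
    intro x hx n
    refine le_trans ?_ ((hQ n).trans (le_abs_self _))
    rw [eval_Qpoly_succ]
    refine (abs_add_le _ _).trans (add_le_add (abs_eval_Ppoly_le _ hx.le) ?_)
    rw [abs_mul, abs_of_pos (by linarith : 0 < √(s : ℝ))]
    gcongr
    exact abs_eval_Ppoly_le _ hx.le
  have hlim : Tendsto (fun n => ∫ x, (Qpoly s (n + 1)).eval x /
      (Qpoly s (n + 1)).eval (fcPole s c) ∂μ) atTop
      (nhds (∫ x, ({fcPole s c} : Set ℝ).indicator (fun _ => (1 : ℝ)) x ∂μ)) := by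
    refine tendsto_integral_of_dominated_convergence (fun x => 1)
      (fun n => (by fun_prop : Continuous _).aestronglyMeasurable) (integrable_const _) ?_ ?_
    · intro n
      filter_upwards [ae_mem_atoms_or_abs_sub_lt hs hK hμ hmom] with x hx
      rw [Real.norm_eq_abs, abs_div, div_le_one (hQ0 n)]
      rcases hx with rfl | rfl | hx
      · exact (hq n).trans ((by linarith [n.cast_nonneg (α := ℝ)] : (1 : ℝ) ≤ n + 1).trans (hQ1 n))
      · exact le_rfl
      · exact hin x hx n
    · filter_upwards [ae_mem_atoms_or_abs_sub_lt hs hK hμ hmom] with x hx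
      by_cases hxw : x = fcPole s c
      · subst hxw
        simp only [Set.mem_singleton_iff, Set.indicator_of_mem]
        refine tendsto_const_nhds.congr fun n => ?_
        rw [div_self (abs_pos.1 (hQ0 n))]
      · rw [Set.indicator_of_notMem (by simpa using hxw)]
        rcases hx with rfl | hx | hx
        · exact tendsto_div_zero_of_abs_le hq hQ1
        · exact absurd hx hxw
        · obtain ⟨M, hM⟩ := exists_abs_eval_Ppoly_le hx
          refine tendsto_div_zero_of_abs_le (M := M + √s * M) (fun n => ?_) hQ1
          rw [eval_Qpoly_succ]
          refine (abs_add_le _ _).trans (add_le_add (hM _) ?_)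
          rw [abs_mul, abs_of_pos (by linarith : 0 < √(s : ℝ))]
          gcongr
          exact hM n
  rw [integral_indicator_const _ (measurableSet_singleton _), smul_eq_mul, mul_one] at hlim
  refine tendsto_nhds_unique hlim ((tendsto_exp_div_eval_Qpoly_fcPole s c).congr fun n => ?_)
  rw [integral_div, hmom]

/-- A compactly supported Borel probability measure with the moments
`∫ Q_n^s dμ = e^{-cn}` equals `η_c^s`. -/
theorem stmt1 (s : ℕ) (hs : 1 ≤ s) (c : ℝ) (μ : Measure ℝ) [IsProbabilityMeasure μ]
    (hcomp : ∃ K : Set ℝ, IsCompact K ∧ μ Kᶜ = 0)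
    (hmom : ∀ n : ℕ, ∫ x, (Qpoly s n).eval x ∂μ = Real.exp (-(c * n))) :
    μ = etaMeas s c := by
  obtain ⟨K, hK, hμ⟩ := hcomp
  have hE : MeasurableSet ({-1 / √s, fcPole s c} : Set ℝ) :=
    ((Set.finite_singleton _).insert _).measurableSet
  have hfc : Measurable fun x => ENNReal.ofReal (fc s c x) := by unfold fc; fun_prop
  have hν : Measurable fun x => ENNReal.ofReal
      (if |x - √s| ≤ 2 then nuDensity s x else 0) := by
    unfold nuDensity
    refine Measurable.ennreal_ofReal (Measurable.ite ?_ ?_ ?_)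
    · exact measurableSet_le (by fun_prop) (by fun_prop)
    all_goals fun_prop
  have hw : Real.exp c + √s + Real.exp (-c) = fcPole s c := by rw [fcPole]; ring
  have hs' : 0 ≤ 1 - 1 / (s : ℝ) := by
    rw [sub_nonneg, div_le_one (by exact_mod_cast hs)]
    exact_mod_cast hs
  have hq : μ {-1 / √s} =
      ENNReal.ofReal (1 - 1 / (s : ℝ)) * ENNReal.ofReal (fc s c (-1 / √s)) := by
    rw [← ENNReal.ofReal_mul hs', ← measureReal_neg_inv hs hK hμ hmom, ofReal_measureReal]
  have hp : μ {fcPole s c} = if c < 0 then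
      ENNReal.ofReal ((Real.exp (-c) - Real.exp c) / (Real.exp (-c) + √s)) else 0 := by
    rw [← ofReal_measureReal (μ := μ), measureReal_fcPole hs hK hμ hmom]
    split_ifs <;> simp
  rw [etaMeas, nuMeas, withDensity_add_measure, ← withDensity_mul _ hν hfc,
    withDensity_smul_measure, dirac_withDensity, hw, smul_smul, ← hq, ← hp,
    ← restrict_compl_atoms_eq hs hK hμ hmom, add_assoc, ← Measure.restrict_singleton,
    ← Measure.restrict_singleton, ← Measure.restrict_union
      (by simpa using (neg_inv_lt_fcPole s c).ne) (measurableSet_singleton _),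
    Set.singleton_union, Measure.restrict_compl_add_restrict hE]
end

section
/- For every integer s ≥ 1 and every real number c ≤ −ln(2 + √s), the total variation distance between η_c^s and ν_s equals (e^{-c} − e^{c})/(e^{-c} + √s). -/
open MeasureTheory Polynomial Filter

theorem integral_sin_sq_div {r : ℝ} (hr0 : r ≠ 0) (hr : |r| ≤ 1) :
    ∫ θ in Set.Ioo 0 Real.pi, 4 * Real.sin θ ^ 2 / (r + r⁻¹ - 2 * Real.cos θ)
      = 2 * Real.pi * r := by
  have hfac : ∀ θ, r + r⁻¹ - 2 * Real.cos θ = (1 + r ^ 2 - 2 * r * Real.cos θ) / r := by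
    intro θ; field_simp; ring
  rw [← integral_Ioc_eq_integral_Ioo, ← intervalIntegral.integral_of_le Real.pi_pos.le]
  rcases hr.lt_or_eq with hlt | heq
  · have hcos : ∀ θ, 0 < 1 - r * Real.cos θ := by
      intro θ
      have h1 : |r * Real.cos θ| < 1 := by
        rw [abs_mul]
        nlinarith [Real.abs_cos_le_one θ, abs_nonneg r, abs_nonneg (Real.cos θ)]
      linarith [le_abs_self (r * Real.cos θ)]
    have hD : ∀ θ, 0 < 1 + r ^ 2 - 2 * r * Real.cos θ := by
      intro θ
      nlinarith [sq_nonneg (r * Real.sin θ), Real.sin_sq_add_cos_sq θ, mul_pos (hcos θ) (hcos θ)]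
    have hder : ∀ θ ∈ Set.uIcc 0 Real.pi, HasDerivAt (fun θ => 2 * r * θ + 2 * Real.sin θ
        + (2 * r ^ 2 - 2) / r * Real.arctan (r * Real.sin θ / (1 - r * Real.cos θ)))
        (4 * Real.sin θ ^ 2 / (r + r⁻¹ - 2 * Real.cos θ)) θ := by
      intro θ _
      have h1 := ((Real.hasDerivAt_sin θ).const_mul r).div
        (((Real.hasDerivAt_cos θ).const_mul r).const_sub 1) (hcos θ).ne'
      have h2 := (((hasDerivAt_id θ).const_mul (2 * r)).add
        ((Real.hasDerivAt_sin θ).const_mul 2)).add (h1.arctan.const_mul ((2 * r ^ 2 - 2) / r))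
      refine h2.congr_deriv ?_
      have h3 := (hcos θ).ne'
      have h4 := (hD θ).ne'
      have hsq : Real.sin θ ^ 2 = 1 - Real.cos θ ^ 2 := by
        linarith [Real.sin_sq_add_cos_sq θ]
      have h5 : 1 + (r * Real.sin θ / (1 - r * Real.cos θ)) ^ 2
          = (1 + r ^ 2 - 2 * r * Real.cos θ) / (1 - r * Real.cos θ) ^ 2 := by
        field_simp
        rw [hsq]; ring
      have h6 : r * Real.cos θ * (1 - r * Real.cos θ) - r * Real.sin θ * (-(r * -Real.sin θ))
          = r * Real.cos θ - r ^ 2 := by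
        linear_combination (-r ^ 2) * hsq
      simp only [Pi.div_apply]
      rw [h5, h6, hfac, hsq]
      generalize Real.cos θ = C at *
      field_simp
      ring
    rw [intervalIntegral.integral_eq_sub_of_hasDerivAt hder]
    · simp
      ring
    · apply Continuous.intervalIntegrable
      refine Continuous.div (by fun_prop) (by fun_prop) fun θ => ?_
      rw [hfac]
      exact div_ne_zero (hD θ).ne' hr0
  · have hr2 : r ^ 2 = 1 := by rw [← sq_abs, heq]; norm_num
    have hcongr : Set.EqOn (fun θ => 4 * Real.sin θ ^ 2 / (r + r⁻¹ - 2 * Real.cos θ))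
        (fun θ => 2 * r + 2 * Real.cos θ) (Set.Ioo 0 Real.pi) := by
      intro θ hθ
      have hs := Real.sin_pos_of_mem_Ioo hθ
      have hsq : Real.sin θ ^ 2 = r ^ 2 - Real.cos θ ^ 2 := by
        linarith [Real.sin_sq_add_cos_sq θ]
      have hrc : r - Real.cos θ ≠ 0 := by
        intro h
        have h' : Real.cos θ = r := by linarith
        rw [h', sub_self] at hsq
        exact (pow_pos hs 2).ne' hsq
      have hinv : r⁻¹ = r := inv_eq_of_mul_eq_one_right (by linarith)
      simp only
      rw [hinv, div_eq_iff (by contrapose! hrc; linarith), hsq]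
      ring
    rw [intervalIntegral.integral_of_le Real.pi_pos.le, integral_Ioc_eq_integral_Ioo,
      setIntegral_congr_fun measurableSet_Ioo hcongr, ← integral_Ioc_eq_integral_Ioo,
      ← intervalIntegral.integral_of_le Real.pi_pos.le, intervalIntegral.integral_add (by simp)
        (by apply Continuous.intervalIntegrable; fun_prop)]
    simp
    ring

theorem image_add_two_mul_cos (a : ℝ) :
    (fun θ => a + 2 * Real.cos θ) '' Set.Ioo 0 Real.pi = Set.Ioo (a - 2) (a + 2) := by
  ext x
  constructor
  · rintro ⟨θ, hθ, rfl⟩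
    have hs := Real.sin_pos_of_mem_Ioo hθ
    have := Real.sin_sq_add_cos_sq θ
    constructor <;> simp only <;> nlinarith
  · rintro ⟨h1, h2⟩
    refine ⟨Real.arccos ((x - a) / 2), ⟨Real.arccos_pos.2 (by linarith), ?_⟩, ?_⟩
    · refine lt_of_le_of_ne (Real.arccos_le_pi _) fun h => ?_
      rw [Real.arccos_eq_pi] at h
      linarith
    · simp only
      rw [Real.cos_arccos (by linarith) (by linarith)]
      ring

theorem integral_semicircle_div (a : ℝ) {r : ℝ} (hr0 : r ≠ 0) (hr : |r| ≤ 1) :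
    ∫ x in Set.Ioo (a - 2) (a + 2), √(4 - (x - a) ^ 2) / (r + r⁻¹ - (x - a))
      = 2 * Real.pi * r := by
  rw [← image_add_two_mul_cos, integral_image_eq_integral_abs_deriv_smul measurableSet_Ioo
    (fun θ _ => (((Real.hasDerivAt_cos θ).const_mul 2).const_add a).hasDerivWithinAt),
    ← integral_sin_sq_div hr0 hr]
  · refine setIntegral_congr_fun measurableSet_Ioo fun θ hθ => ?_
    have hs := Real.sin_pos_of_mem_Ioo hθ
    have hsqrt : √(4 - (a + 2 * Real.cos θ - a) ^ 2) = 2 * Real.sin θ := by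
      rw [Real.sqrt_eq_iff_mul_self_eq_of_pos (by linarith)]
      linear_combination 4 * Real.sin_sq_add_cos_sq θ
    have habs : |2 * -Real.sin θ| = 2 * Real.sin θ := by
      rw [mul_neg, abs_neg, abs_of_pos (by linarith)]
    simp only [smul_eq_mul]
    rw [hsqrt, habs, add_sub_cancel_left]
    ring
  · intro θ hθ φ hφ h
    exact Real.injOn_cos (Set.Ioo_subset_Icc_self hθ) (Set.Ioo_subset_Icc_self hφ)
      (by simpa using h)

theorem integrableOn_semicircle_div (a : ℝ) {r : ℝ} (hr0 : r ≠ 0) (hr : |r| ≤ 1) :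
    IntegrableOn (fun x => √(4 - (x - a) ^ 2) / (r + r⁻¹ - (x - a)))
      (Set.Ioo (a - 2) (a + 2)) := by
  refine Integrable.of_integral_ne_zero ?_
  rw [integral_semicircle_div a hr0 hr]
  have := Real.pi_pos
  positivity

theorem one_add_mul_sqrt_nonneg {s : ℕ} {x : ℝ} (hx : |x - √s| ≤ 2) : 0 ≤ x * √s + 1 := by
  nlinarith [abs_le.1 hx, Real.sqrt_nonneg (s : ℝ), sq_nonneg (√s - 1)]

theorem lintegral_nuMeas {s : ℕ} {h : ℝ → ℝ} (hm : Measurable h)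
    (hnonneg : ∀ x, |x - √s| ≤ 2 → 0 ≤ h x)
    (hint : IntegrableOn (fun x => nuDensity s x * h x) (Set.Ioo (√s - 2) (√s + 2))) :
    ∫⁻ x, ENNReal.ofReal (h x) ∂nuMeas s
      = ENNReal.ofReal (∫ x in Set.Ioo (√s - 2) (√s + 2), nuDensity s x * h x)
        + ENNReal.ofReal (1 - 1 / (s : ℝ)) * ENNReal.ofReal (h (-1 / √s)) := by
  have hset : ∀ x, x ∈ Set.Icc (√s - 2) (√s + 2) ↔ |x - √s| ≤ 2 := by
    intro x
    rw [abs_le, Set.mem_Icc]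
    constructor <;> rintro ⟨h1, h2⟩ <;> constructor <;> linarith
  have hdm : Measurable (nuDensity s) := by unfold nuDensity; fun_prop
  have hpm : Measurable fun x => ENNReal.ofReal (if |x - √s| ≤ 2 then nuDensity s x else 0) :=
    (Measurable.ite (measurableSet_le (by fun_prop) measurable_const) hdm
      measurable_const).ennreal_ofReal
  have hd0 : ∀ x, |x - √s| ≤ 2 → 0 ≤ nuDensity s x := fun x hx =>
    div_nonneg (Real.sqrt_nonneg _)
      (mul_nonneg (by positivity) (one_add_mul_sqrt_nonneg hx))
  unfold nuMeas
  rw [lintegral_add_measure, lintegral_smul_measure, lintegral_dirac' _ hm.ennreal_ofReal,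
    smul_eq_mul, lintegral_withDensity_eq_lintegral_mul _ hpm hm.ennreal_ofReal]
  congr 1
  rw [ofReal_integral_eq_lintegral_ofReal hint
    ((ae_restrict_iff' measurableSet_Ioo).2 (.of_forall fun x hx => ?_)),
    setLIntegral_congr Ioo_ae_eq_Icc, ← lintegral_indicator measurableSet_Icc]
  · refine lintegral_congr fun x => ?_
    by_cases hx : |x - √s| ≤ 2
    · rw [Set.indicator_of_mem ((hset x).2 hx), ENNReal.ofReal_mul (hd0 x hx)]
      simp [hx]
    · rw [Set.indicator_of_notMem (fun h' => hx ((hset x).1 h'))]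
      simp [hx]
  · have hx' := (hset x).1 (Set.Ioo_subset_Icc_self hx)
    exact mul_nonneg (hd0 x hx') (hnonneg x hx')

theorem abs_neg_inv_sqrt_le_one {s : ℕ} (hs : 1 ≤ s) : |-(√s)⁻¹| ≤ 1 := by
  rw [abs_neg, abs_of_nonneg (by positivity)]
  exact inv_le_one_of_one_le₀ (Real.one_le_sqrt.2 (by exact_mod_cast hs))

theorem sqrt_natCast_pos {s : ℕ} (hs : 1 ≤ s) : 0 < √(s : ℝ) :=
  Real.sqrt_pos.2 (by exact_mod_cast hs)

theorem nuDensity_eq {s : ℕ} (hs : 1 ≤ s) (x : ℝ) :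
    nuDensity s x = -(2 * Real.pi * √s)⁻¹ *
      (√(4 - (x - √s) ^ 2) / (-(√s)⁻¹ + (-(√s)⁻¹)⁻¹ - (x - √s))) := by
  have ha := sqrt_natCast_pos hs
  have h1 : -(√s)⁻¹ + (-(√s)⁻¹)⁻¹ - (x - √s) = -((x * √s + 1) / √s) := by
    rw [inv_neg, inv_inv]
    field_simp
    ring
  rw [h1, nuDensity, div_neg, neg_mul_neg]
  rcases eq_or_ne (x * √s + 1) 0 with h0 | h0
  · simp [h0]
  · field_simp

theorem nuMeas_univ {s : ℕ} (hs : 1 ≤ s) : nuMeas s Set.univ = 1 := by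
  have ha := sqrt_natCast_pos hs
  have hsq : √(s : ℝ) ^ 2 = s := Real.sq_sqrt (Nat.cast_nonneg s)
  have h0 : -(√(s : ℝ))⁻¹ ≠ 0 := by simp [ha.ne']
  have h1 := abs_neg_inv_sqrt_le_one hs
  have h := lintegral_nuMeas (s := s) (h := fun _ => 1) measurable_const (by simp) (by
    simp only [mul_one, nuDensity_eq hs]
    exact (integrableOn_semicircle_div _ h0 h1).const_mul _)
  simp only [mul_one, nuDensity_eq hs] at h
  rw [integral_const_mul, integral_semicircle_div _ h0 h1] at h
  have h2 : -(2 * Real.pi * √(s : ℝ))⁻¹ * (2 * Real.pi * -(√(s : ℝ))⁻¹) = 1 / s := by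
    have := Real.pi_pos
    field_simp
    rw [hsq]
  have hs' : (1 : ℝ) ≤ s := by exact_mod_cast hs
  rw [h2, ENNReal.ofReal_one, mul_one, lintegral_one, ← ENNReal.ofReal_add (by positivity)
    (by rw [sub_nonneg]; exact (div_le_one (by linarith)).2 hs')] at h
  simpa using h

theorem exp_neg_add_sqrt {s : ℕ} {c : ℝ} (hc : c ≤ -Real.log (2 + √s)) :
    2 + √s ≤ Real.exp (-c) := by
  rw [← Real.log_le_iff_le_exp (by positivity)]
  linarith

theorem fc_mem_Icc {s : ℕ} {c x : ℝ} (hc : c ≤ -Real.log (2 + √s)) (hx : x ≤ √s + 2) :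
    fc s c x ∈ Set.Icc 0 1 := by
  have h1 := exp_neg_add_sqrt hc
  have h2 := Real.exp_pos c
  have h3 := Real.sqrt_nonneg (s : ℝ)
  unfold fc
  constructor
  · apply div_nonneg <;> linarith
  · apply div_le_one_of_le₀ <;> linarith

theorem neg_one_div_sqrt_le (s : ℕ) : -1 / √(s : ℝ) ≤ √s + 2 := by
  have h := Real.sqrt_nonneg (s : ℝ)
  have : -1 / √(s : ℝ) ≤ 0 := div_nonpos_of_nonpos_of_nonneg (by norm_num) h
  linarith

theorem measurable_fc (s : ℕ) (c : ℝ) : Measurable (fc s c) := by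
  unfold fc; fun_prop

theorem nuDensity_mul_fc {s : ℕ} (hs : 1 ≤ s) {c x : ℝ} (hc : c ≤ -Real.log (2 + √s))
    (hx : x ∈ Set.Ioo (√(s : ℝ) - 2) (√s + 2)) :
    nuDensity s x * fc s c x = (2 * Real.pi * (Real.exp (-c) + √s))⁻¹ *
      (√(4 - (x - √s) ^ 2) / (Real.exp c + (Real.exp c)⁻¹ - (x - √s))
        - √(4 - (x - √s) ^ 2) / (-(√s)⁻¹ + (-(√s)⁻¹)⁻¹ - (x - √s))) := by
  have ha := sqrt_natCast_pos hs
  have hE := exp_neg_add_sqrt hc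
  have he := Real.exp_pos c
  have hee : Real.exp c * Real.exp (-c) = 1 := by rw [← Real.exp_add]; simp
  have hpi := Real.pi_pos
  have hxp : 0 < x * √s + 1 := by
    nlinarith [mul_pos (sub_pos.2 hx.1) ha, sq_nonneg (√(s : ℝ) - 1)]
  have h1 : -(√(s : ℝ))⁻¹ + (-(√(s : ℝ))⁻¹)⁻¹ - (x - √s) = -((x * √s + 1) / √s) := by
    rw [inv_neg, inv_inv]
    field_simp
    ring
  have hz : 0 < Real.exp c + Real.exp (-c) + √s - x := by linarith [hx.2]
  have h2 : Real.exp c + Real.exp (-c) - (x - √s) = Real.exp c + Real.exp (-c) + √s - x := by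
    ring
  rw [h1, ← Real.exp_neg, h2, nuDensity, fc, div_neg, sub_neg_eq_add]
  have hEa : 0 < Real.exp (-c) + √s := by linarith
  generalize √(4 - (x - √s) ^ 2) = q
  generalize Real.exp (-c) = E at *
  generalize Real.exp c = e at *
  generalize √(s : ℝ) = a at *
  field_simp
  linear_combination q * hee

theorem lintegral_fc_nuMeas {s : ℕ} (hs : 1 ≤ s) {c : ℝ} (hc : c ≤ -Real.log (2 + √s)) :
    ∫⁻ x, ENNReal.ofReal (fc s c x) ∂nuMeas s
      = ENNReal.ofReal ((Real.exp c + √s) / (Real.exp (-c) + √s)) := by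
  have ha := sqrt_natCast_pos hs
  have hsq : √(s : ℝ) ^ 2 = s := Real.sq_sqrt (Nat.cast_nonneg s)
  have hs' : (1 : ℝ) ≤ s := by exact_mod_cast hs
  have hE := exp_neg_add_sqrt hc
  have he := Real.exp_pos c
  have hee : Real.exp c * Real.exp (-c) = 1 := by rw [← Real.exp_add]; simp
  have hpi := Real.pi_pos
  have h0 : -(√(s : ℝ))⁻¹ ≠ 0 := by simp [ha.ne']
  have h1 := abs_neg_inv_sqrt_le_one hs
  have he1 : |Real.exp c| ≤ 1 := by
    rw [abs_of_pos he]
    nlinarith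
  have hcongr : Set.EqOn (fun x => nuDensity s x * fc s c x) _ (Set.Ioo (√(s : ℝ) - 2) (√s + 2)) :=
    fun x hx => nuDensity_mul_fc hs hc hx
  have hi1 := integrableOn_semicircle_div (√s) he.ne' he1
  have hi2 := integrableOn_semicircle_div (√s) h0 h1
  have hlint := lintegral_nuMeas (s := s) (measurable_fc s c)
    (fun x hx => (fc_mem_Icc hc (by linarith [(abs_le.1 hx).2])).1)
    (IntegrableOn.congr_fun ((hi1.sub hi2).const_mul _) hcongr.symm measurableSet_Ioo)
  have hatom : 0 ≤ 1 - 1 / (s : ℝ) := by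
    rw [sub_nonneg]; exact (div_le_one (by linarith)).2 hs'
  have hf := (fc_mem_Icc hc (neg_one_div_sqrt_le s)).1
  rw [hlint, setIntegral_congr_fun measurableSet_Ioo hcongr, integral_const_mul,
    integral_sub hi1 hi2, integral_semicircle_div _ he.ne' he1, integral_semicircle_div _ h0 h1,
    ← ENNReal.ofReal_mul hatom, ← ENNReal.ofReal_add _ (mul_nonneg hatom hf)]
  · congr 1
    have hEa : 0 < Real.exp (-c) + √s := by linarith
    have hz : 0 < Real.exp c + Real.exp (-c) + √s - -1 / √s := by
      have : -1 / √(s : ℝ) < 0 := div_neg_of_neg_of_pos (by norm_num) ha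
      linarith
    have hzf : Real.exp c + Real.exp (-c) + √s - -1 / √s
        = (Real.exp (-c) + √s) * (Real.exp c + √s) / √s := by
      field_simp
      linear_combination -hee
    have hea : 0 < Real.exp c + √s := by linarith
    have hs1 : 1 / (s : ℝ) = 1 / √s ^ 2 := by rw [hsq]
    rw [fc, hzf, hs1]
    generalize √(s : ℝ) = a at *
    field_simp
    ring
  · have hEa : 0 < Real.exp (-c) + √s := by linarith
    have : 2 * Real.pi * Real.exp c - 2 * Real.pi * -(√s)⁻¹
      = 2 * Real.pi * (Real.exp c + (√s)⁻¹) := by ring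
    rw [this]
    positivity

theorem ae_nuMeas_le (s : ℕ) : ∀ᵐ x ∂nuMeas s, x ≤ √s + 2 := by
  rw [ae_iff]
  have hms : MeasurableSet {x : ℝ | ¬x ≤ √s + 2} :=
    (measurableSet_le measurable_id measurable_const).compl
  rw [nuMeas, Measure.add_apply, withDensity_apply _ hms, Measure.smul_apply,
    Measure.dirac_apply' _ hms, Set.indicator_of_notMem (by simpa using neg_one_div_sqrt_le s),
    smul_zero, add_zero]
  refine setLIntegral_eq_zero hms fun x hx => ?_
  have : ¬|x - √s| ≤ 2 := fun h => hx (by linarith [(abs_le.1 h).2])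
  simp [this]

/-- Removing mass from a probability measure and placing it on a null set changes it, in total
variation, by exactly the mass that was moved. -/
theorem dTV_add_smul_dirac {μ κ : Measure ℝ} [IsProbabilityMeasure μ] (hle : κ ≤ μ) {p m : ℝ}
    (hm : 0 ≤ m) (hκ : κ Set.univ = ENNReal.ofReal (1 - m)) (hm1 : m ≤ 1) (hp : μ {p} = 0) :
    dTV (κ + ENNReal.ofReal m • Measure.dirac p) μ = m := by
  have : IsFiniteMeasure κ := isFiniteMeasure_of_le μ hle
  have : IsFiniteMeasure (ENNReal.ofReal m • Measure.dirac p) :=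
    Measure.smul_finite _ ENNReal.ofReal_ne_top
  have hval : ∀ A, MeasurableSet A → ((κ + ENNReal.ofReal m • Measure.dirac p) A).toReal
      = κ.real A + m * A.indicator 1 p := by
    intro A hA
    rw [← measureReal_def, measureReal_add_apply, measureReal_ennreal_smul_apply,
      ENNReal.toReal_ofReal hm]
    congr 2
    rw [measureReal_def, Measure.dirac_apply' _ hA]
    by_cases h : p ∈ A <;> simp [h]
  have hmono : ∀ A, κ.real A ≤ μ.real A := fun A =>
    ENNReal.toReal_mono (measure_ne_top _ _) (hle A)
  have hκu : κ.real Set.univ = 1 - m := by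
    rw [measureReal_def, hκ, ENNReal.toReal_ofReal (by linarith)]
  have hbound : ∀ A : {A : Set ℝ // MeasurableSet A},
      |((κ + ENNReal.ofReal m • Measure.dirac p) A.1).toReal - (μ A.1).toReal| ≤ m := by
    rintro ⟨A, hA⟩
    simp only
    rw [hval A hA, ← measureReal_def]
    have h1 := hmono A
    have h2 := hmono Aᶜ
    rw [measureReal_compl hA, measureReal_compl hA, hκu, probReal_univ] at h2
    by_cases h : p ∈ A <;> simp [h] <;> rw [abs_le] <;> constructor <;> linarith
  refine le_antisymm (Real.iSup_le hbound hm) ?_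
  refine le_ciSup_of_le ⟨m, by rintro _ ⟨A, rfl⟩; exact hbound A⟩
    ⟨{p}, measurableSet_singleton p⟩ ?_
  simp only
  rw [hval _ (measurableSet_singleton p), measureReal_def, hp,
    nonpos_iff_eq_zero.1 ((hle {p}).trans_eq hp)]
  simp [le_abs_self]

/-- For `c ≤ -ln(2 + √s)`, the total variation distance between `η_c^s` and `ν_s`
equals `(e^{-c} - e^c)/(e^{-c} + √s)`. -/
theorem stmt10 (s : ℕ) (hs : 1 ≤ s) (c : ℝ) (hc : c ≤ -Real.log (2 + Real.sqrt s)) :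
    dTV (etaMeas s c) (nuMeas s) =
      (Real.exp (-c) - Real.exp c) / (Real.exp (-c) + Real.sqrt s) := by
  have : IsProbabilityMeasure (nuMeas s) := ⟨nuMeas_univ hs⟩
  have ha := Real.sqrt_nonneg (s : ℝ)
  have hE := exp_neg_add_sqrt hc
  have he := Real.exp_pos c
  have hc0 : c < 0 := by
    have := Real.log_pos (show 1 < 2 + √(s : ℝ) by linarith)
    linarith
  have he1 : Real.exp c < 1 := Real.exp_lt_one_iff.2 hc0
  rw [etaMeas, if_pos hc0]
  apply dTV_add_smul_dirac
  · calc (nuMeas s).withDensity (fun x => ENNReal.ofReal (fc s c x))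
        ≤ (nuMeas s).withDensity 1 := withDensity_mono <| by
          filter_upwards [ae_nuMeas_le s] with x hx
          exact ENNReal.ofReal_le_one.2 (fc_mem_Icc hc hx).2
      _ = nuMeas s := withDensity_one
  · apply div_nonneg <;> linarith
  · rw [withDensity_apply _ .univ, Measure.restrict_univ, lintegral_fc_nuMeas hs hc]
    congr 1
    field_simp
    ring
  · apply div_le_one_of_le₀ <;> linarith
  · refine measure_mono_null ?_ (ae_iff.1 (ae_nuMeas_le s))
    rintro x rfl
    simp only [Set.mem_ofPred_eq, not_le]
    linarith
end
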